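/- arXiv:1909.12265 — 6 statements merged into one kernel-verified Lean document; each statement's English description precedes it below -/
import Mathlib

section
/- Let k ≥ 2 be an integer and let G be a finite subgroup of the orthogonal group O(2k) (acting on ℝ^{2k}) such that every element g ∈ G with g ≠ 1 has fixed subspace {v ∈ ℝ^{2k} : g v = v} of dimension at most 1, and such that there is at least one element of G whose fixed subspace has dimension exactly 1. Then G is isomorphic to ℤ/2ℤ; equivalently, G has exactly two elements. -/
/-- The fixed subspace `{v : ℝ^n | A v = v}` of a matrix `A`, as a submodule of `ℝ^n`. -/
noncomputable def fixedSubspace {n : ℕ} (A : Matrix (Fin n) (Fin n) ℝ) :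
    Submodule ℝ (Fin n → ℝ) :=
  LinearMap.ker (A.mulVecLin - LinearMap.id)

open Matrix in
lemma mem_fixedSubspace_iff' {n : ℕ} (A : Matrix (Fin n) (Fin n) ℝ) (v : Fin n → ℝ) :
    v ∈ fixedSubspace A ↔ A *ᵥ v = v := by
  simp [fixedSubspace, sub_eq_zero]

open Matrix in
lemma orth_dot {n : ℕ} {A : Matrix (Fin n) (Fin n) ℝ} (hA : Aᵀ * A = 1) (x y : Fin n → ℝ) :
    (A *ᵥ x) ⬝ᵥ (A *ᵥ y) = x ⬝ᵥ y := by
  rw [Matrix.dotProduct_mulVec, Matrix.vecMul_mulVec, hA, Matrix.vecMul_one]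

open Matrix in
lemma exists_eig_of_det_neg {n : ℕ} (hn : Even n) {A : Matrix (Fin n) (Fin n) ℝ}
    (hA : Aᵀ * A = 1) (hd : A.det = -1) (e : ℝ) (he : e * e = 1) :
    ∃ w : Fin n → ℝ, w ≠ 0 ∧ A *ᵥ w = e • w := by
  have hA' : A * Aᵀ = 1 := mul_eq_one_comm.mp hA
  have h0 : (A - e • (1 : Matrix (Fin n) (Fin n) ℝ)).det = 0 := by
    have h1 : A - e • (1 : Matrix (Fin n) (Fin n) ℝ)
        = (-e) • (A * (A - e • (1 : Matrix (Fin n) (Fin n) ℝ))ᵀ) := by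
      rw [transpose_sub, mul_sub, hA']
      simp [smul_sub, smul_smul, he]
      abel
    have he2 : (-e) ^ n = 1 := by
      obtain ⟨m, rfl⟩ := hn
      rw [pow_add, ← mul_pow, neg_mul_neg, he, one_pow]
    have h2 := congrArg Matrix.det h1
    rw [det_smul, det_mul, det_transpose, hd, Fintype.card_fin, he2] at h2
    linarith
  obtain ⟨w, hw, hw'⟩ := Matrix.exists_mulVec_eq_zero_iff.mpr h0
  refine ⟨w, hw, ?_⟩
  rw [sub_mulVec, smul_mulVec, one_mulVec] at hw'
  exact sub_eq_zero.mp hw'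

open Matrix in
lemma orth_of_eig {n : ℕ} {A : Matrix (Fin n) (Fin n) ℝ} (hA : Aᵀ * A = 1) {e : ℝ}
    (he : e * e = 1) {v w : Fin n → ℝ} (hv : A *ᵥ v = e • v) (hw : A *ᵥ w = (-e) • w) :
    v ⬝ᵥ w = 0 := by
  have h := orth_dot hA v w
  rw [hv, hw, smul_dotProduct, dotProduct_smul, smul_eq_mul, smul_eq_mul] at h
  have : e * (-e * (v ⬝ᵥ w)) = -(e * e) * (v ⬝ᵥ w) := by ring
  rw [this, he] at h
  linarith

open Matrix in
lemma exists_orth_eig {n : ℕ} (hn : Even n) {A : Matrix (Fin n) (Fin n) ℝ}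
    (hA : Aᵀ * A = 1) {e : ℝ} (he : e * e = 1) {v : Fin n → ℝ} (hv0 : v ≠ 0)
    (hv : A *ᵥ v = e • v) :
    ∃ (w : Fin n → ℝ) (e' : ℝ), w ≠ 0 ∧ v ⬝ᵥ w = 0 ∧ e' * e' = 1 ∧ A *ᵥ w = e' • w := by
  have hdd : A.det * A.det = 1 := by
    have := congrArg Matrix.det hA
    rwa [det_mul, det_transpose, det_one] at this
  have hvv : v ⬝ᵥ v ≠ 0 := by rwa [Ne, dotProduct_self_eq_zero]
  have hne : (-e) * (-e) = 1 := by rw [neg_mul_neg, he]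
  rcases mul_self_eq_one_iff.mp hdd with hd | hd
  · set R : Matrix (Fin n) (Fin n) ℝ := 1 - vecMulVec ((2 / (v ⬝ᵥ v)) • v) v with hR
    have hRx : ∀ x, R *ᵥ x = x - (2 / (v ⬝ᵥ v) * (v ⬝ᵥ x)) • v := by
      intro x
      rw [hR, sub_mulVec, one_mulVec, vecMulVec_mulVec]
      ext i
      simp
      ring
    have hRt : Rᵀ = R := by
      rw [hR, transpose_sub, transpose_one, transpose_vecMulVec]
      ext i j
      simp [vecMulVec_apply]
    have hRR : Rᵀ * R = 1 := by
      rw [hRt]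
      apply Matrix.ext_of_mulVec_single
      intro i
      rw [← mulVec_mulVec, hRx, hRx, one_mulVec, dotProduct_sub, dotProduct_smul]
      ext j
      simp
      field_simp
      ring
    have hRd : R.det = -1 := by
      rw [hR, sub_eq_add_neg, ← neg_vecMulVec, vecMulVec_eq Unit,
        det_one_add_replicateCol_mul_replicateRow]
      simp
      field_simp
      norm_num
    have hB : (A * R)ᵀ * (A * R) = 1 := by
      rw [transpose_mul, Matrix.mul_assoc, ← Matrix.mul_assoc Aᵀ, hA, Matrix.one_mul, hRR]
    have hBd : (A * R).det = -1 := by rw [det_mul, hd, hRd]; norm_num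
    have hBv : (A * R) *ᵥ v = (-e) • v := by
      rw [← mulVec_mulVec, hRx, div_mul_cancel₀ _ hvv, mulVec_sub, mulVec_smul, hv]
      module
    obtain ⟨w, hw0, hw⟩ := exists_eig_of_det_neg hn hB hBd e he
    have ho := orth_of_eig hB hne hBv (w := w) (by rw [neg_neg]; exact hw)
    refine ⟨w, e, hw0, ho, he, ?_⟩
    rw [← mulVec_mulVec, hRx, ho] at hw
    simpa using hw
  · obtain ⟨w, hw0, hw⟩ := exists_eig_of_det_neg hn hA hd (-e) hne
    exact ⟨w, -e, hw0, orth_of_eig hA he hv hw, hne, hw⟩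

open Matrix in
/-- Two vectors in a fixed space of dimension at most one are proportional. -/
lemma proportional {n : ℕ} {A : Matrix (Fin n) (Fin n) ℝ}
    (h : Module.finrank ℝ (fixedSubspace A) ≤ 1) {v w : Fin n → ℝ} (hv0 : v ≠ 0)
    (hv : A *ᵥ v = v) (hw : A *ᵥ w = w) : ∃ c : ℝ, w = c • v := by
  obtain ⟨u, hu⟩ := finrank_le_one_iff.mp h
  obtain ⟨a, ha⟩ := hu ⟨v, (mem_fixedSubspace_iff' A v).mpr hv⟩
  obtain ⟨b, hb⟩ := hu ⟨w, (mem_fixedSubspace_iff' A w).mpr hw⟩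
  have ha' : a • (u : Fin n → ℝ) = v := congrArg Subtype.val ha
  have hb' : b • (u : Fin n → ℝ) = w := congrArg Subtype.val hb
  have ha0 : a ≠ 0 := by
    rintro rfl
    exact hv0 (by rw [← ha', zero_smul])
  refine ⟨b / a, ?_⟩
  rw [← ha', ← hb', smul_smul, div_mul_cancel₀ _ ha0]

open Matrix in
/-- The orthogonal complement of two vectors. -/
noncomputable def perpTwo {n : ℕ} (v w : Fin n → ℝ) : Submodule ℝ (Fin n → ℝ) :=
  LinearMap.ker (Matrix.mulVecLin (Matrix.of ![v, w]))

open Matrix in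
lemma mem_perpTwo {n : ℕ} (v w x : Fin n → ℝ) :
    x ∈ perpTwo v w ↔ v ⬝ᵥ x = 0 ∧ w ⬝ᵥ x = 0 := by
  simp [perpTwo, funext_iff, Fin.forall_fin_two, mulVec]

lemma finrank_perpTwo {n : ℕ} (v w : Fin n → ℝ) :
    n ≤ Module.finrank ℝ (perpTwo v w) + 2 := by
  have h := LinearMap.finrank_range_add_finrank_ker (Matrix.mulVecLin (Matrix.of ![v, w]))
  have h2 := Submodule.finrank_le (LinearMap.range (Matrix.mulVecLin (Matrix.of ![v, w])))
  rw [Module.finrank_fin_fun] at h h2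
  unfold perpTwo
  omega

open Matrix in
/-- The orthogonal complement of a vector. -/
noncomputable def perpOne {n : ℕ} (v : Fin n → ℝ) : Submodule ℝ (Fin n → ℝ) :=
  LinearMap.ker (Matrix.mulVecLin (Matrix.of ![v]))

open Matrix in
lemma mem_perpOne {n : ℕ} (v x : Fin n → ℝ) :
    x ∈ perpOne v ↔ v ⬝ᵥ x = 0 := by
  simp [perpOne, funext_iff, mulVec]

lemma finrank_perpOne {n : ℕ} (v : Fin n → ℝ) :
    n ≤ Module.finrank ℝ (perpOne v) + 1 := by
  have h := LinearMap.finrank_range_add_finrank_ker (Matrix.mulVecLin (Matrix.of ![v]))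
  have h2 := Submodule.finrank_le (LinearMap.range (Matrix.mulVecLin (Matrix.of ![v])))
  rw [Module.finrank_fin_fun] at h h2
  unfold perpOne
  omega

open Matrix in
/-- If `g` is an involution fixing only the line through `v`, it is `-1` on the complement. -/
lemma neg_on_perp {n : ℕ} {A : Matrix (Fin n) (Fin n) ℝ} (hA : Aᵀ * A = 1) (hAA : A * A = 1)
    (h : Module.finrank ℝ (fixedSubspace A) ≤ 1) {v x : Fin n → ℝ} (hv0 : v ≠ 0)
    (hv : A *ᵥ v = v) (hx : v ⬝ᵥ x = 0) : A *ᵥ x = -x := by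
  obtain ⟨c, hc⟩ := proportional h hv0 hv (w := A *ᵥ x + x) (by
    rw [mulVec_add, mulVec_mulVec, hAA, one_mulVec, add_comm])
  have hvv : v ⬝ᵥ v ≠ 0 := by rwa [Ne, dotProduct_self_eq_zero]
  have h1 : v ⬝ᵥ (A *ᵥ x) = 0 := by
    have := orth_dot hA v x
    rwa [hv, hx] at this
  have h2 := congrArg (fun y => v ⬝ᵥ y) hc
  simp only [dotProduct_add, dotProduct_smul, h1, hx, smul_eq_mul] at h2
  have hc0 : c = 0 := by
    rcases mul_eq_zero.mp (by linarith : c * (v ⬝ᵥ v) = 0) with h | h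
    · exact h
    · exact absurd h hvv
  rw [hc0, zero_smul] at hc
  exact eq_neg_of_add_eq_zero_left hc

open Matrix in
/-- Lemma 2.2: if `G` is a finite subgroup of `O(2k)` (`k ≥ 2`) such that every nontrivial
element has fixed subspace of dimension at most 1, and some element has fixed subspace of
dimension exactly 1, then `G` has exactly two elements. -/
theorem finite_subgroup_orthogonal_card_eq_two (k : ℕ) (hk : 2 ≤ k)
    (G : Subgroup (Matrix.orthogonalGroup (Fin (2 * k)) ℝ)) (hG : Finite G)
    (h1 : ∀ g ∈ G, g ≠ 1 →
      Module.finrank ℝ (fixedSubspace (g : Matrix (Fin (2 * k)) (Fin (2 * k)) ℝ)) ≤ 1)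
    (h2 : ∃ g ∈ G,
      Module.finrank ℝ (fixedSubspace (g : Matrix (Fin (2 * k)) (Fin (2 * k)) ℝ)) = 1) :
    Nat.card G = 2 := by
  obtain ⟨g, hgG, hg⟩ := h2
  have horth : ∀ h : Matrix.orthogonalGroup (Fin (2 * k)) ℝ, (h.1)ᵀ * h.1 = 1 := fun h =>
    (Matrix.mem_orthogonalGroup_iff' _ _).mp h.2
  have hg1 : g ≠ 1 := by
    rintro rfl
    have : fixedSubspace ((1 : Matrix.orthogonalGroup (Fin (2 * k)) ℝ) :
        Matrix (Fin (2 * k)) (Fin (2 * k)) ℝ) = ⊤ := by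
      rw [eq_top_iff]
      intro x _
      rw [mem_fixedSubspace_iff']
      simp
    rw [this, finrank_top, Module.finrank_fin_fun] at hg
    omega
  -- a nonzero fixed vector
  obtain ⟨v, hv0, hv⟩ : ∃ v : Fin (2 * k) → ℝ, v ≠ 0 ∧ g.1 *ᵥ v = v := by
    have : fixedSubspace g.1 ≠ ⊥ := by
      intro h
      rw [h, finrank_bot] at hg
      omega
    obtain ⟨v, hv, hv0⟩ := Submodule.exists_mem_ne_zero_of_ne_bot this
    exact ⟨v, hv0, (mem_fixedSubspace_iff' _ _).mp hv⟩
  have hvv : v ⬝ᵥ v ≠ 0 := by rwa [Ne, dotProduct_self_eq_zero]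
  -- elements preserving the line are involutions
  have key : ∀ h ∈ G, ∀ e : ℝ, e * e = 1 → h.1 *ᵥ v = e • v → h * h = 1 := by
    intro h hh e he hhv
    by_contra hne
    obtain ⟨w, e', hw0, hvw, he', hw⟩ := exists_orth_eig (even_two_mul k) (horth h) he hv0 hhv
    obtain ⟨c, hc⟩ := proportional (h1 _ (G.mul_mem hh hh) hne) hv0 (w := w)
      (by rw [Matrix.UnitaryGroup.mul_val, ← mulVec_mulVec, hhv, mulVec_smul, hhv, smul_smul, he,
        one_smul])
      (by rw [Matrix.UnitaryGroup.mul_val, ← mulVec_mulVec, hw, mulVec_smul, hw, smul_smul, he',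
        one_smul])
    rw [hc, dotProduct_smul, smul_eq_mul, mul_eq_zero] at hvw
    rcases hvw with h0 | h0
    · exact hw0 (by rw [hc, h0, zero_smul])
    · exact hvv h0
  have hgg : g * g = 1 := key g hgG 1 (by norm_num) (by rw [one_smul, hv])
  have hgg' : g.1 * g.1 = 1 := congrArg Subtype.val hgg
  have hneg : ∀ x, v ⬝ᵥ x = 0 → g.1 *ᵥ x = -x := fun x hx =>
    neg_on_perp (horth g) hgg' hg.le hv0 hv hx
  -- every element preserves the line
  have line : ∀ h ∈ G, ∃ e : ℝ, e * e = 1 ∧ h.1 *ᵥ v = e • v := by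
    intro h hh
    have hcomm : g * (h * g * h⁻¹) = 1 := by
      by_contra hne
      have hle := h1 _ (G.mul_mem hgG (G.mul_mem (G.mul_mem hh hgG) (G.inv_mem hh))) hne
      have hsub : perpTwo v (h.1 *ᵥ v) ≤ fixedSubspace (g * (h * g * h⁻¹)).1 := by
        intro x hx
        rw [mem_perpTwo] at hx
        obtain ⟨hx1, hx2⟩ := hx
        rw [mem_fixedSubspace_iff']
        have hy : h.1 *ᵥ (h⁻¹.1 *ᵥ x) = x := by
          rw [mulVec_mulVec, ← Matrix.UnitaryGroup.mul_val, mul_inv_cancel,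
            Matrix.UnitaryGroup.one_val, one_mulVec]
        have hy2 : v ⬝ᵥ (h⁻¹.1 *ᵥ x) = 0 := by
          rw [← orth_dot (horth h), hy, hx2]
        simp only [Matrix.UnitaryGroup.mul_val, ← mulVec_mulVec]
        rw [hneg _ hy2, mulVec_neg, hy, mulVec_neg, hneg _ hx1, neg_neg]
      have := Submodule.finrank_mono hsub
      have := finrank_perpTwo v (h.1 *ᵥ v)
      omega
    have hcomm2 : g * h = h * g := by
      have : h * g * h⁻¹ = g := by
        have h3 : g * (h * g * h⁻¹) = g * g := by rw [hcomm, hgg]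
        exact mul_left_cancel h3
      rw [← mul_inv_eq_iff_eq_mul.mp this]
    have hfix : g.1 *ᵥ (h.1 *ᵥ v) = h.1 *ᵥ v := by
      rw [mulVec_mulVec, ← Matrix.UnitaryGroup.mul_val, hcomm2, Matrix.UnitaryGroup.mul_val,
        ← mulVec_mulVec, hv]
    obtain ⟨c, hc⟩ := proportional hg.le hv0 hv hfix
    refine ⟨c, ?_, hc⟩
    have := orth_dot (horth h) v v
    rw [hc, smul_dotProduct, dotProduct_smul, smul_eq_mul, smul_eq_mul, ← mul_assoc] at this
    exact mul_right_cancel₀ hvv (by rw [this, one_mul])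
  -- conclusion
  have main : ∀ h ∈ G, h = 1 ∨ h = g := by
    intro h hh
    by_contra hcon
    push Not at hcon
    obtain ⟨hne1, hneg'⟩ := hcon
    obtain ⟨e, he, hhv⟩ := line h hh
    have hhh : h * h = 1 := key h hh e he hhv
    have hhh' : h.1 * h.1 = 1 := congrArg Subtype.val hhh
    have hgh : g * h ≠ 1 := by
      intro h3
      exact hneg' (mul_left_cancel (h3.trans hgg.symm))
    have hle1 := h1 h hh hne1
    have hle2 := h1 _ (G.mul_mem hgG hh) hgh
    have hsub : perpOne v ≤ fixedSubspace h.1 ⊔ fixedSubspace (g * h).1 := by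
      intro x hx
      rw [mem_perpOne] at hx
      have hhx : v ⬝ᵥ (h.1 *ᵥ x) = 0 := by
        have := orth_dot (horth h) v (h.1 *ᵥ x)
        rw [mulVec_mulVec, hhh', one_mulVec, hhv, smul_dotProduct, hx, smul_zero] at this
        exact this.symm
      refine Submodule.mem_sup.mpr ⟨(1 / 2 : ℝ) • (x + h.1 *ᵥ x), ?_,
        (1 / 2 : ℝ) • (x - h.1 *ᵥ x), ?_, ?_⟩
      · rw [mem_fixedSubspace_iff', mulVec_smul, mulVec_add, mulVec_mulVec, hhh', one_mulVec,
          add_comm]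
      · rw [mem_fixedSubspace_iff', Matrix.UnitaryGroup.mul_val, ← mulVec_mulVec, mulVec_smul,
          mulVec_sub, mulVec_mulVec, hhh', one_mulVec, mulVec_smul, mulVec_sub, hneg _ hhx,
          hneg _ hx]
        module
      · module
    have h3 := Submodule.finrank_mono hsub
    have h4 := Submodule.finrank_add_le_finrank_add_finrank (fixedSubspace h.1)
      (fixedSubspace (g * h).1)
    have h5 := finrank_perpOne v
    omega
  rw [Nat.card_eq_two_iff]
  refine ⟨⟨1, G.one_mem⟩, ⟨g, hgG⟩, ?_, ?_⟩
  · intro h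
    exact hg1 (congrArg Subtype.val h).symm
  · ext ⟨h, hh⟩
    simpa using main h hh
end

section
/- Let k ≥ 2 be an integer and let A be an orthogonal transformation of ℝ^{k+1} satisfying A² = I or A² = −I. Let f denote the induced map on the real projective space ℙ(ℝ^{k+1}) (the projectivization of ℝ^{k+1}), sending the line spanned by a nonzero vector v to the line spanned by A v. Then the fixed-point set {p ∈ ℙ(ℝ^{k+1}) : f(p) = p} is either empty or fails to be discrete in the subspace topology; in particular, f cannot have a nonempty set of isolated fixed points. -/
open scoped LinearAlgebra.Projectivization

/-- The quotient topology on the projectivization of a topological vector space. -/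
instance projectivizationTopology (K V : Type*) [DivisionRing K] [AddCommGroup V]
    [Module K V] [TopologicalSpace V] : TopologicalSpace (ℙ K V) :=
  inferInstanceAs (TopologicalSpace (Quotient (projectivizationSetoid K V)))

/-- If `u, w` are independent eigenvectors of the same eigenvalue, the fixed set is not discrete. -/
lemma not_discrete_aux {V : Type*} [NormedAddCommGroup V] [NormedSpace ℝ V]
    (f : ℙ ℝ V → ℙ ℝ V) (A : V →ₗ[ℝ] V) (hA : Function.Injective A)
    (hf : f = Projectivization.map A hA) (e : ℝ) (u w : V)
    (hu : A u = e • u) (hw : A w = e • w)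
    (hli : LinearIndependent ℝ ![u, w]) :
    ¬ DiscreteTopology {p : ℙ ℝ V | f p = p} := by
  intro hd
  rw [LinearIndependent.pair_iff] at hli
  have hne : ∀ t : ℝ, u + t • w ≠ 0 := by
    intro t h
    have := hli 1 t (by simpa using h)
    simp at this
  have hfix : ∀ t : ℝ, f (Projectivization.mk ℝ (u + t • w) (hne t)) =
      Projectivization.mk ℝ (u + t • w) (hne t) := by
    intro t
    subst hf
    rw [Projectivization.map_mk, Projectivization.mk_eq_mk_iff']
    refine ⟨e, ?_⟩
    rw [map_add, map_smul, hu, hw, smul_add, smul_comm]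
  let g : ℝ → {p : ℙ ℝ V | f p = p} := fun t => ⟨Projectivization.mk ℝ (u + t • w) (hne t), hfix t⟩
  have hg : Continuous g := by
    refine Continuous.subtype_mk ?_ _
    have h1 : Continuous (fun t : ℝ => (⟨u + t • w, hne t⟩ : {v : V // v ≠ 0})) :=
      Continuous.subtype_mk (by fun_prop) _
    have h2 : Continuous (fun v : {v : V // v ≠ 0} =>
        (Quotient.mk (projectivizationSetoid ℝ V) v)) := continuous_quotient_mk'
    exact h2.comp h1
  have h01 : g 0 = g 1 := PreconnectedSpace.constant inferInstance hg
  have h := congrArg Subtype.val h01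
  simp only [g] at h
  rw [Projectivization.mk_eq_mk_iff'] at h
  obtain ⟨a, ha⟩ := h
  have := hli (a - 1) a (by
    have h3 : a • u + a • w = u := by simpa using ha
    rw [sub_smul, one_smul]
    calc a • u - u + a • w = (a • u + a • w) - u := by abel
      _ = 0 := by rw [h3, sub_self])
  linarith [this.1, this.2]

/-- Lemma 2.1 (linear-algebraic content): if `A` is an orthogonal transformation of `ℝ^{k+1}`
(`k ≥ 2`) with `A² = I` or `A² = -I`, then the fixed-point set of the induced map on real
projective space `ℙ(ℝ^{k+1})` is either empty or is not discrete. -/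
theorem fixedPoints_of_involution_on_projective_space_not_isolated (k : ℕ) (hk : 2 ≤ k)
    (A : EuclideanSpace ℝ (Fin (k + 1)) ≃ₗᵢ[ℝ] EuclideanSpace ℝ (Fin (k + 1)))
    (hA : (∀ x, A (A x) = x) ∨ (∀ x, A (A x) = -x))
    (f : ℙ ℝ (EuclideanSpace ℝ (Fin (k + 1))) → ℙ ℝ (EuclideanSpace ℝ (Fin (k + 1))))
    (hf : f = Projectivization.map A.toLinearEquiv.toLinearMap A.injective) :
    {p : ℙ ℝ (EuclideanSpace ℝ (Fin (k + 1))) | f p = p} = ∅ ∨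
      ¬ DiscreteTopology {p : ℙ ℝ (EuclideanSpace ℝ (Fin (k + 1))) | f p = p} := by
  have hinj : Function.Injective A.toLinearEquiv.toLinearMap := A.injective
  rcases hA with hA | hA
  · right
    set L : EuclideanSpace ℝ (Fin (k + 1)) →ₗ[ℝ] EuclideanSpace ℝ (Fin (k + 1)) :=
      A.toLinearEquiv.toLinearMap with hL
    have hLL : ∀ x, L (L x) = x := hA
    have key : ∃ e : ℝ, 1 < Module.finrank ℝ (LinearMap.ker (L - e • LinearMap.id)) := by
      by_contra! hcon
      have h1 := hcon 1
      have h2 := hcon (-1)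
      have htop : LinearMap.ker (L - (1 : ℝ) • LinearMap.id) ⊔
          LinearMap.ker (L - (-1 : ℝ) • LinearMap.id) = ⊤ := by
        rw [eq_top_iff]
        intro x _
        rw [Submodule.mem_sup]
        refine ⟨(1 / 2 : ℝ) • (x + L x), ?_, (1 / 2 : ℝ) • (x - L x), ?_, ?_⟩
        · simp [hLL, add_comm]
        · simp only [LinearMap.mem_ker, LinearMap.sub_apply, LinearMap.smul_apply,
            LinearMap.id_apply, map_smul, map_sub, hLL]
          module
        · module
      have h3 := Submodule.finrank_add_le_finrank_add_finrank
        (LinearMap.ker (L - (1 : ℝ) • LinearMap.id)) (LinearMap.ker (L - (-1 : ℝ) • LinearMap.id))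
      rw [htop, finrank_top, finrank_euclideanSpace_fin] at h3
      omega
    obtain ⟨e, he⟩ := key
    have : Nontrivial (LinearMap.ker (L - e • LinearMap.id)) :=
      Module.nontrivial_of_finrank_pos (R := ℝ) (by omega)
    obtain ⟨u, hu⟩ := exists_ne (0 : LinearMap.ker (L - e • LinearMap.id))
    obtain ⟨w, hw⟩ := exists_linearIndependent_pair_of_one_lt_finrank he hu
    refine not_discrete_aux f L hinj hf e u w ?_ ?_ ?_
    · have := LinearMap.mem_ker.1 u.2
      rwa [LinearMap.sub_apply, sub_eq_zero] at this
    · have := LinearMap.mem_ker.1 w.2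
      rwa [LinearMap.sub_apply, sub_eq_zero] at this
    · rw [LinearIndependent.pair_iff] at hw ⊢
      intro s t h
      exact hw s t (Subtype.ext (by simpa using h))
  · left
    rw [Set.eq_empty_iff_forall_notMem]
    intro p hp
    induction p using Projectivization.ind with
    | h v hv =>
      rw [Set.mem_ofPred_eq, hf, Projectivization.map_mk, Projectivization.mk_eq_mk_iff'] at hp
      obtain ⟨a, ha⟩ := hp
      have ha' : A v = a • v := ha.symm
      have h2 := hA v
      rw [ha', map_smul, ha', smul_smul] at h2
      have h3 : (a * a + 1) • v = 0 := by rw [add_smul, h2]; simp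
      rcases smul_eq_zero.1 h3 with h | h
      · nlinarith [mul_self_nonneg a]
      · exact hv h
end

section
/- Let k ≥ 2 be an integer and let G be a finite subgroup of the orthogonal group O(2k) (acting on ℝ^{2k}) such that every element g ∈ G with g ≠ 1 has fixed subspace {v ∈ ℝ^{2k} : g v = v} of dimension at most 1. If σ ∈ G has fixed subspace of dimension exactly 1, then σ² = 1, i.e., σ has order 2. -/
open Matrix in
theorem aux_add {m : ℕ} (A : Matrix (Fin m) (Fin m) ℝ) (hA : A * Aᵀ = 1) (hd : A.det = -1) :
    (A + 1).det = 0 := by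
  have h : A + 1 = A * (A + 1)ᵀ := by
    rw [transpose_add, mul_add, hA, transpose_one, mul_one, add_comm]
  have h2 := congrArg Matrix.det h
  rw [det_mul, det_transpose, hd] at h2
  linarith

open Matrix in
theorem aux_sub {k : ℕ} (A : Matrix (Fin (2 * k)) (Fin (2 * k)) ℝ) (hA : A * Aᵀ = 1)
    (hd : A.det = -1) : (A - 1).det = 0 := by
  have h : A - 1 = A * (-(A - 1))ᵀ := by
    rw [transpose_neg, transpose_sub, mul_neg, mul_sub, hA, transpose_one, mul_one, neg_sub]
  have h2 := congrArg Matrix.det h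
  rw [det_mul, det_transpose, hd, det_neg] at h2
  simp at h2
  linarith

open Matrix in
theorem aux_eig {k : ℕ} (A : Matrix (Fin (2 * k)) (Fin (2 * k)) ℝ) (hA : A * Aᵀ = 1)
    (v : Fin (2 * k) → ℝ) (hv : v ≠ 0) (hAv : A *ᵥ v = v)
    (huniq : ∀ w, A *ᵥ w = w → ∃ c : ℝ, c • v = w) :
    ∃ w, w ≠ 0 ∧ A *ᵥ w = -w := by
  have hdd : A.det * A.det = 1 := by
    have := congrArg Matrix.det hA
    rwa [det_mul, det_transpose, det_one] at this
  rcases mul_self_eq_one_iff.1 hdd with hd | hd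
  · exfalso
    have hc : v ⬝ᵥ v ≠ 0 := fun h => hv (dotProduct_self_eq_zero.1 h)
    set c := v ⬝ᵥ v with hcdef
    set R : Matrix (Fin (2 * k)) (Fin (2 * k)) ℝ := 1 + vecMulVec (-(2 / c) • v) v with hR
    have hRmul : ∀ w, R *ᵥ w = w - (2 / c * (v ⬝ᵥ w)) • v := by
      intro w
      rw [hR, add_mulVec, one_mulVec, vecMulVec_mulVec]
      ext i
      simp
      ring
    have hRT : Rᵀ = R := by
      rw [hR, transpose_add, transpose_one, transpose_vecMulVec]
      congr 1
      ext i j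
      simp [vecMulVec_apply]
      ring
    have hRR : R * R = 1 := by
      apply Matrix.ext_of_mulVec_single
      intro i
      rw [← mulVec_mulVec, hRmul, hRmul, dotProduct_sub, dotProduct_smul, ← hcdef, one_mulVec]
      ext j
      simp
      field_simp
      ring
    have hRd : R.det = -1 := by
      rw [hR, vecMulVec_eq Unit, det_one_add_replicateCol_mul_replicateRow, dotProduct_smul, ← hcdef]
      simp
      field_simp
      norm_num
    have hM : (A * R) * (A * R)ᵀ = 1 := by
      rw [transpose_mul, hRT, mul_assoc, ← mul_assoc R, hRR, one_mul, hA]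
    have hMd : (A * R).det = -1 := by rw [det_mul, hd, hRd]; norm_num
    obtain ⟨w, hw0, hw⟩ := exists_mulVec_eq_zero_iff.2 (aux_sub _ hM hMd)
    rw [sub_mulVec, one_mulVec, sub_eq_zero, ← mulVec_mulVec, hRmul, mulVec_sub, mulVec_smul,
      hAv] at hw
    have hAtv : v ᵥ* A = v := by
      rw [← mulVec_transpose]
      conv_lhs => rw [← hAv]
      rw [mulVec_mulVec, mul_eq_one_comm.1 hA, one_mulVec]
    have hvw : v ⬝ᵥ w = 0 := by
      have := congrArg (fun x => v ⬝ᵥ x) hw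
      simp only [dotProduct_sub, dotProduct_smul, dotProduct_mulVec, hAtv, ← hcdef, smul_eq_mul]
        at this
      field_simp at this
      linarith
    rw [hvw, mul_zero, zero_smul, sub_zero] at hw
    obtain ⟨a, rfl⟩ := huniq w hw
    rw [dotProduct_smul, smul_eq_mul, ← hcdef] at hvw
    rcases mul_eq_zero.1 hvw with h | h
    · exact hw0 (by rw [h, zero_smul])
    · exact hc h
  · obtain ⟨w, hw0, hw⟩ := exists_mulVec_eq_zero_iff.2 (aux_add _ hA hd)
    rw [add_mulVec, one_mulVec] at hw
    exact ⟨w, hw0, eq_neg_of_add_eq_zero_left hw⟩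

theorem mem_fixed {n : ℕ} (A : Matrix (Fin n) (Fin n) ℝ) (v : Fin n → ℝ) :
    v ∈ fixedSubspace A ↔ A.mulVec v = v := by
  simp [fixedSubspace, sub_eq_zero]

/-- If `G` is a finite subgroup of `O(2k)` (`k ≥ 2`) in which every nontrivial element has
fixed subspace of dimension at most 1, then any element `σ ∈ G` whose fixed subspace has
dimension exactly 1 satisfies `σ² = 1`. -/
theorem sq_eq_one_of_finrank_fixedSubspace_eq_one (k : ℕ) (hk : 2 ≤ k)
    (G : Subgroup (Matrix.orthogonalGroup (Fin (2 * k)) ℝ)) (hG : Finite G)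
    (h1 : ∀ g ∈ G, g ≠ 1 →
      Module.finrank ℝ (fixedSubspace (g : Matrix (Fin (2 * k)) (Fin (2 * k)) ℝ)) ≤ 1)
    (σ : Matrix.orthogonalGroup (Fin (2 * k)) ℝ) (hσ : σ ∈ G)
    (hdσ : Module.finrank ℝ (fixedSubspace (σ : Matrix (Fin (2 * k)) (Fin (2 * k)) ℝ)) = 1) :
    σ ^ 2 = 1 := by
  by_contra hne
  have hle := h1 (σ ^ 2) (G.pow_mem hσ 2) hne
  obtain ⟨⟨v, hvm⟩, hv0, hvu⟩ := finrank_eq_one_iff'.1 hdσ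
  have hv : v ≠ 0 := fun h => hv0 (Subtype.ext h)
  have hAv := (mem_fixed _ _).1 hvm
  obtain ⟨w, hw0, hw⟩ := aux_eig σ.1 ((Matrix.mem_orthogonalGroup_iff _ _).1 σ.2) v hv hAv (by
    intro w hw
    obtain ⟨c, hc⟩ := hvu ⟨w, (mem_fixed _ _).2 hw⟩
    exact ⟨c, congrArg Subtype.val hc⟩)
  have hsq : ((σ ^ 2 : Matrix.orthogonalGroup (Fin (2 * k)) ℝ) :
      Matrix (Fin (2 * k)) (Fin (2 * k)) ℝ) = σ.1 * σ.1 := by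
    rw [pow_two]; rfl
  have hv2 : v ∈ fixedSubspace ((σ ^ 2 : Matrix.orthogonalGroup (Fin (2 * k)) ℝ) :
      Matrix (Fin (2 * k)) (Fin (2 * k)) ℝ) := by
    rw [mem_fixed, hsq, ← Matrix.mulVec_mulVec, hAv, hAv]
  have hw2 : w ∈ fixedSubspace ((σ ^ 2 : Matrix.orthogonalGroup (Fin (2 * k)) ℝ) :
      Matrix (Fin (2 * k)) (Fin (2 * k)) ℝ) := by
    rw [mem_fixed, hsq, ← Matrix.mulVec_mulVec, hw, Matrix.mulVec_neg, hw, neg_neg]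
  obtain ⟨⟨u, hu⟩, hall⟩ := finrank_le_one_iff.1 hle
  obtain ⟨a, ha⟩ := hall ⟨v, hv2⟩
  obtain ⟨b, hb⟩ := hall ⟨w, hw2⟩
  have ha' : a • u = v := congrArg Subtype.val ha
  have hb' : b • u = w := congrArg Subtype.val hb
  have ha0 : a ≠ 0 := by
    rintro rfl
    exact hv (by rw [← ha', zero_smul])
  have hwv : w = (b / a) • v := by
    rw [← ha', ← hb', smul_smul, div_mul_cancel₀ _ ha0]
  have hfix : σ.1.mulVec w = w := by
    rw [hwv, Matrix.mulVec_smul, hAv]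
  rw [hfix] at hw
  exact hw0 (self_eq_neg.1 hw)
end

section
/- Let ι be a finite index type, and for each i ∈ ι let G_i be a group and N_i a normal subgroup of G_i which is torsion-free (i.e., N_i contains no nontrivial element of finite order). Let φ be the group homomorphism from the free product ∗_{i∈ι} G_i to the direct product ∏_{i∈ι} (G_i / N_i) induced by the quotient homomorphisms G_i → G_i / N_i on each free factor. Then the kernel of φ is torsion-free: every element of ker(φ) of finite order is the identity. -/
open Monoid Monoid.CoprodI in
theorem aux_neWord_prod_ne_one {ι : Type*} {G : ι → Type*} [∀ i, Group (G i)]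
    {i j : ι} (v : NeWord G i j) : v.prod ≠ 1 := by
  classical
  intro h
  have h1 : v.toWord = Word.empty := by
    apply (Word.equiv (M := G)).symm.injective
    change v.toWord.prod = Word.empty.prod
    rw [Word.prod_empty]; exact h
  exact v.toList_ne_nil (congrArg Word.toList h1)

open Monoid Monoid.CoprodI in
theorem aux_neWord_pow {ι : Type*} {G : ι → Type*} [∀ i, Group (G i)]
    {i j : ι} (hij : i ≠ j) (v : NeWord G i j) (n : ℕ) :
    ∃ v' : NeWord G i j, v'.prod = v.prod ^ (n + 1) := by
  induction n with
  | zero => exact ⟨v, by simp⟩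
  | succ n ih =>
    obtain ⟨v', hv'⟩ := ih
    exact ⟨NeWord.append v' hij.symm v, by rw [NeWord.append_prod, hv', ← pow_succ]⟩

open Monoid Monoid.CoprodI in
/-- Cyclic reduction: every reduced word is conjugate to an element of a factor or to
a cyclically reduced word. -/
theorem aux_cyclic_reduction {ι : Type*} {G : ι → Type*} [∀ i, Group (G i)] (n : ℕ) :
    ∀ w : Word G, w.toList.length ≤ n →
      w.prod = 1 ∨ (∃ (i : ι) (g : G i), IsConj (of g) w.prod) ∨
      (∃ (i j : ι) (v : NeWord G i j), i ≠ j ∧ IsConj v.prod w.prod) := by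
  induction n with
  | zero =>
    rintro ⟨l, h1, h2⟩ hl
    left
    have : l = [] := by simpa using hl
    subst this
    simp [Word.prod]
  | succ n ih =>
    rintro ⟨l, h1, h2⟩ hl
    rcases l with _ | ⟨⟨i, a⟩, l⟩
    · left; simp [Word.prod]
    rcases List.eq_nil_or_concat l with rfl | ⟨mid, ⟨j, b⟩, hmb⟩
    · right; left
      exact ⟨i, a, by
        have : Word.prod ⟨[⟨i, a⟩], h1, h2⟩ = of a := by simp [Word.prod]
        rw [this]⟩
    rw [List.concat_eq_append] at hmb
    subst hmb
    by_cases hij : i = j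
    · subst hij
      have hmid : ∀ l ∈ mid, Sigma.snd l ≠ 1 := fun l hl => h1 l (by simp [hl])
      have h3 : (⟨i, a⟩ :: mid : List (Σ i, G i)).IsChain (fun l l' => l.1 ≠ l'.1) :=
        List.IsChain.left_of_append (l₂ := [⟨i, b⟩]) (by simpa using h2)
      by_cases hba : b * a = 1
      · have key := ih ⟨mid, hmid, h3.tail⟩ (by simp at hl ⊢; omega)
        have hc : IsConj (Word.prod ⟨mid, hmid, h3.tail⟩)
            (Word.prod ⟨⟨i, a⟩ :: (mid ++ [⟨i, b⟩]), h1, h2⟩) := by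
          rw [isConj_iff]
          refine ⟨of a, ?_⟩
          have : b = a⁻¹ := eq_inv_of_mul_eq_one_left hba
          simp [Word.prod, this, mul_assoc]
        rcases key with h | ⟨i', g, h⟩ | ⟨i', j', v, hne, h⟩
        · left; rw [h] at hc; exact isConj_one_right.mp hc
        · exact Or.inr (Or.inl ⟨i', g, h.trans hc⟩)
        · exact Or.inr (Or.inr ⟨i', j', v, hne, h.trans hc⟩)
      · have h4 : (⟨i, b * a⟩ :: mid : List (Σ i, G i)).IsChain (fun l l' => l.1 ≠ l'.1) := by
          rw [List.isChain_cons] at h3 ⊢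
          exact h3
        have h5 : ∀ l ∈ (⟨i, b * a⟩ :: mid : List (Σ i, G i)), Sigma.snd l ≠ 1 := by
          rw [List.forall_mem_cons]
          exact ⟨hba, hmid⟩
        have key := ih ⟨_, h5, h4⟩ (by simp at hl ⊢; omega)
        have hc : IsConj (Word.prod ⟨_, h5, h4⟩)
            (Word.prod ⟨⟨i, a⟩ :: (mid ++ [⟨i, b⟩]), h1, h2⟩) := by
          rw [isConj_iff]
          refine ⟨(of b)⁻¹, ?_⟩
          simp [Word.prod, mul_assoc]
        rcases key with h | ⟨i', g, h⟩ | ⟨i', j', v, hne, h⟩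
        · left; rw [h] at hc; exact isConj_one_right.mp hc
        · exact Or.inr (Or.inl ⟨i', g, h.trans hc⟩)
        · exact Or.inr (Or.inr ⟨i', j', v, hne, h.trans hc⟩)
    · right; right
      obtain ⟨i', j', v, hv⟩ := NeWord.of_word
        (⟨⟨i, a⟩ :: (mid ++ [⟨j, b⟩]), h1, h2⟩ : Word G)
        (fun h => by simpa [Word.empty] using congrArg Word.toList h)
      have hl' : v.toList = ⟨i, a⟩ :: (mid ++ [⟨j, b⟩]) := congrArg Word.toList hv
      have e1 := v.toList_head?
      have e2 := v.toList_getLast?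
      rw [hl'] at e1 e2
      rw [← List.cons_append, List.getLast?_append] at e2
      simp only [List.head?_cons, Option.some.injEq] at e1
      simp at e2
      refine ⟨i', j', v, ?_, ?_⟩
      · have e3 : i = i' := congrArg Sigma.fst e1
        rw [← e2.1, ← e3]
        exact hij
      · rw [← hv]; exact IsConj.refl _

/-- Kernel of the natural map from a free product to the product of quotients by torsion-free
normal subgroups is torsion-free. -/
theorem torsionFree_ker_coprodI_to_pi_quotient (ι : Type*) [Finite ι] [DecidableEq ι]
    (G : ι → Type*) [∀ i, Group (G i)]
    (N : ∀ i, Subgroup (G i)) [∀ i, (N i).Normal]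
    (htf : ∀ i, ∀ g : G i, g ∈ N i → IsOfFinOrder g → g = 1)
    (φ : Monoid.CoprodI G →* (∀ i, G i ⧸ N i))
    (hφ : ∀ (i : ι) (g : G i),
      φ (Monoid.CoprodI.of g) = Pi.mulSingle i (QuotientGroup.mk g)) :
    ∀ x : Monoid.CoprodI G, φ x = 1 → IsOfFinOrder x → x = 1 := by
  classical
  intro x hx hfin
  have hxw : (Monoid.CoprodI.Word.equiv x).prod = x := Monoid.CoprodI.Word.equiv.symm_apply_apply x
  have key := aux_cyclic_reduction _ (Monoid.CoprodI.Word.equiv x) le_rfl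
  rw [hxw] at key
  rcases key with h | ⟨i, g, h⟩ | ⟨i, j, v, hne, h⟩
  · exact h
  · obtain ⟨c, hc⟩ := isConj_iff.mp h
    have hg1 : φ (Monoid.CoprodI.of g) = 1 := by
      have := φ.map_isConj h
      rw [hx] at this
      exact isConj_one_left.mp this
    have hgN : g ∈ N i := by
      rw [hφ, Pi.mulSingle_eq_one_iff] at hg1
      exact (QuotientGroup.eq_one_iff g).mp hg1
    have hgf : IsOfFinOrder g := by
      rw [isOfFinOrder_iff_pow_eq_one] at hfin ⊢
      obtain ⟨n, hn, hxn⟩ := hfin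
      refine ⟨n, hn, Monoid.CoprodI.of_injective i ?_⟩
      rw [← hc, conj_pow, conj_eq_one_iff] at hxn
      rw [map_pow, hxn, map_one]
    rw [htf i g hgN hgf] at hc
    rw [← hc]; simp
  · exfalso
    obtain ⟨c, hc⟩ := isConj_iff.mp h
    obtain ⟨n, hn, hxn⟩ := isOfFinOrder_iff_pow_eq_one.mp hfin
    rw [← hc, conj_pow, conj_eq_one_iff] at hxn
    obtain ⟨m, rfl⟩ : ∃ m, n = m + 1 := ⟨n - 1, by omega⟩
    obtain ⟨v', hv'⟩ := aux_neWord_pow hne v m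
    exact aux_neWord_prod_ne_one v' (hv'.trans hxn)
end

section
/- Let G_1, …, G_m be finitely many groups such that each G_i contains a torsion-free normal subgroup of finite index. Then the free product G_1 ∗ ⋯ ∗ G_m contains a torsion-free normal subgroup of finite index. -/
open Monoid.CoprodI in
theorem aux_pow {ι : Type*} {G : ι → Type*} [∀ i, Group (G i)] {i j : ι} (hij : i ≠ j)
    (w : NeWord G i j) (n : ℕ) : ∃ w' : NeWord G i j, w'.prod = w.prod ^ (n + 1) := by
  induction n with
  | zero => exact ⟨w, by simp⟩
  | succ n ih =>
    obtain ⟨w', hw'⟩ := ih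
    exact ⟨NeWord.append w' hij.symm w, by rw [NeWord.append_prod, hw', pow_succ _ (n + 1)]⟩

open Monoid.CoprodI in
theorem aux_ne {ι : Type*} {G : ι → Type*} [∀ i, Group (G i)] {i j : ι}
    (w : NeWord G i j) : w.prod ≠ 1 := by
  classical
  intro h
  have h2 : w.toWord = Word.empty := by
    apply (Word.equiv (M := G)).symm.injective
    change w.toWord.prod = Word.empty.prod
    rw [Word.prod_empty]
    exact h
  exact w.toList_ne_nil (congrArg Word.toList h2)

open Monoid.CoprodI in
theorem aux_key {ι : Type*} {G : ι → Type*} [∀ i, Group (G i)] (n : ℕ) :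
    ∀ l : List (Σ i, G i), l.length ≤ n → (∀ x ∈ l, x.2 ≠ 1) →
      l.IsChain (fun x y => x.1 ≠ y.1) →
      IsOfFinOrder (l.map fun x => (of x.2 : Monoid.CoprodI G)).prod →
      (l.map fun x => (of x.2 : Monoid.CoprodI G)).prod = 1 ∨
      ∃ (i : ι) (g : G i) (c : Monoid.CoprodI G),
        (l.map fun x => (of x.2 : Monoid.CoprodI G)).prod = c * of g * c⁻¹ := by
  classical
  induction n with
  | zero =>
    intro l hl _ _ _
    left
    have : l = [] := List.length_eq_zero_iff.mp (by omega)
    simp [this]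
  | succ n ih =>
    intro l hl h1 hc hf
    rcases l with _ | ⟨⟨i, x⟩, t⟩
    · left; simp
    rcases List.eq_nil_or_concat' t with rfl | ⟨mid, ⟨j, y⟩, rfl⟩
    · right; exact ⟨i, x, 1, by simp⟩
    by_cases hij : i = j
    · subst hij
      have hm1 : ∀ z ∈ mid, z.2 ≠ 1 := fun z hz => h1 z (by simp [hz])
      have hcm' : (⟨i, x⟩ :: mid : List (Σ i, G i)).IsChain (fun x y => x.1 ≠ y.1) := by
        rw [← List.cons_append] at hc
        exact (List.isChain_append.mp hc).1
      have hcm := hcm'.tail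
      simp only [List.tail_cons] at hcm
      -- the product of the conjugated word
      set p := (mid.map fun x => (of x.2 : Monoid.CoprodI G)).prod with hp
      have hprod : ((⟨i, x⟩ :: (mid ++ [⟨i, y⟩]) : List (Σ i, G i)).map
          fun x => (of x.2 : Monoid.CoprodI G)).prod
          = (of y)⁻¹ * (of (y * x) * p) * ((of y)⁻¹)⁻¹ := by
        simp [hp, mul_assoc]
      rw [hprod] at hf ⊢
      have hf' : IsOfFinOrder (of (y * x) * p) := by
        rw [isOfFinOrder_iff_pow_eq_one] at hf ⊢
        obtain ⟨k, hk, e⟩ := hf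
        refine ⟨k, hk, ?_⟩
        rw [conj_pow] at e
        exact conj_eq_one_iff.mp e
      have main : of (y * x) * p = 1 ∨ ∃ (i : ι) (g : G i) (c : Monoid.CoprodI G),
          of (y * x) * p = c * of g * c⁻¹ := by
        by_cases hyx : y * x = 1
        · rw [hyx, map_one, one_mul] at hf' ⊢
          exact ih mid (by simp at hl; omega) hm1 hcm hf'
        · have := ih (⟨i, y * x⟩ :: mid) (by simp at hl ⊢; omega)
            (by
              intro z hz
              rcases List.mem_cons.mp hz with rfl | hz
              · exact hyx
              · exact hm1 z hz)
            (by
              rw [List.isChain_cons] at hcm' ⊢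
              exact hcm')
          simp only [List.map_cons, List.prod_cons] at this
          exact this hf'
      rcases main with h | ⟨k, g, c, h⟩
      · left; rw [h]; simp
      · right; exact ⟨k, g, (of y)⁻¹ * c, by rw [h]; simp [mul_assoc]⟩
    · exfalso
      obtain ⟨i', j', w', hw⟩ := NeWord.of_word (M := G)
        ⟨⟨i, x⟩ :: (mid ++ [⟨j, y⟩]), h1, hc⟩
        (fun h => by simpa [Word.empty] using congrArg Word.toList h)
      have hl : w'.toList = ⟨i, x⟩ :: (mid ++ [⟨j, y⟩]) := congrArg Word.toList hw
      have hh := w'.toList_head?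
      have hg := w'.toList_getLast?
      rw [hl] at hh hg
      rw [← List.cons_append, List.getLast?_append] at hg
      simp only [List.head?_cons, Option.some.injEq, Sigma.mk.injEq] at hh
      simp at hg
      obtain ⟨rfl, -⟩ := hh
      obtain ⟨rfl, -⟩ := hg
      rw [isOfFinOrder_iff_pow_eq_one] at hf
      obtain ⟨k, hk, e⟩ := hf
      obtain ⟨k, rfl⟩ : ∃ q, k = q + 1 := ⟨k - 1, by omega⟩
      obtain ⟨w2, hw2⟩ := aux_pow hij w' k
      apply aux_ne w2
      rw [hw2, ← e]
      congr 1
      change w'.toWord.prod = _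
      rw [hw]
      rfl

/-- If each of the groups `G 1, …, G m` contains a torsion-free normal subgroup of finite
index, then so does their free product. -/
theorem coprodI_exists_torsionFree_normal_finiteIndex (m : ℕ)
    (G : Fin m → Type*) [∀ i, Group (G i)]
    (h : ∀ i, ∃ N : Subgroup (G i), N.Normal ∧ N.FiniteIndex ∧
      ∀ g ∈ N, IsOfFinOrder g → g = 1) :
    ∃ H : Subgroup (Monoid.CoprodI G), H.Normal ∧ H.FiniteIndex ∧
      ∀ g ∈ H, IsOfFinOrder g → g = 1 := by
  classical
  choose N hN hfin htf using h
  let f : Monoid.CoprodI G →* (∀ i, G i ⧸ N i) :=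
    Monoid.CoprodI.lift fun i =>
      (MonoidHom.mulSingle (fun i => G i ⧸ N i) i).comp (QuotientGroup.mk' (N i))
  have hfinite : Finite (∀ i, G i ⧸ N i) := inferInstance
  refine ⟨f.ker, inferInstance, inferInstance, ?_⟩
  intro g hg hgo
  have hprod : ((Monoid.CoprodI.Word.equiv g).toList.map
      fun x => (Monoid.CoprodI.of x.2 : Monoid.CoprodI G)).prod = g :=
    Monoid.CoprodI.Word.equiv.symm_apply_apply g
  have key := aux_key _ (Monoid.CoprodI.Word.equiv g).toList le_rfl
    (fun x hx => (Monoid.CoprodI.Word.equiv g).ne_one x hx)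
    (Monoid.CoprodI.Word.equiv g).chain_ne
  rw [hprod] at key
  rcases key hgo with h | ⟨i, a, c, rfl⟩
  · exact h
  have ha : f (Monoid.CoprodI.of a) = 1 := by
    have := MonoidHom.mem_ker.mp hg
    simpa [mul_inv_eq_one] using this
  have haN : a ∈ N i := by
    simp only [f, Monoid.CoprodI.lift_of] at ha
    have := congrFun ha i
    simpa using this
  have hao : IsOfFinOrder a := by
    rw [isOfFinOrder_iff_pow_eq_one] at hgo ⊢
    obtain ⟨k, hk, e⟩ := hgo
    refine ⟨k, hk, Monoid.CoprodI.of_injective i ?_⟩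
    rw [conj_pow] at e
    simpa [mul_inv_eq_one] using e
  rw [htf i a haN hao]
  simp
end

section
/- Let ι be a finite index type and for each i ∈ ι let G_i be a group which is either finite or contains a normal subgroup of finite index isomorphic to ℤ. Then the free product ∗_{i∈ι} G_i is virtually free: it contains a subgroup of finite index which is a free group. -/
/-- An action `ρ` of `G` on `A` is "free" as a groupoid: cocycles `G × A → X` are freely
determined by their values on a family of generators. -/
def IsFreeAct {G A : Type} [Group G] (ρ : G →* Equiv.Perm A) : Prop :=
  ∃ (E : Type) (γ : E → G) (s : E → A), ∀ (X : Type) [Group X] (f : E → X),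
    ∃! c : G → A → X, (∀ g h a, c (g * h) a = c g (ρ h a) * c h a) ∧ ∀ e, c (γ e) (s e) = f e

/-- If the stabilizers are free then the action groupoid is free. -/
theorem isFreeAct_of_stabilizer {G A : Type} [Group G] [MulAction G A]
    (hs : ∀ a : A, IsFreeGroup (MulAction.stabilizer G a)) :
    IsFreeAct (MulAction.toPermHom G A) := by
  classical
  let r : A → A := fun a => (Quotient.mk (MulAction.orbitRel G A) a).out
  have hr : ∀ (g : G) (a : A), r (g • a) = r a := by
    intro g a
    have : (Quotient.mk (MulAction.orbitRel G A) (g • a)) = Quotient.mk _ a :=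
      Quotient.sound (MulAction.orbitRel_apply.2 ⟨g, rfl⟩)
    simp only [r, this]
  have hex : ∀ a : A, ∃ t : G, t • r a = a ∧ (a = r a → t = 1) := by
    intro a
    by_cases h : a = r a
    · exact ⟨1, by rw [one_smul]; exact h.symm, fun _ => rfl⟩
    · have h1 : (MulAction.orbitRel G A) (r a) a := Quotient.mk_out (s := MulAction.orbitRel G A) a
      obtain ⟨t, ht⟩ := MulAction.orbitRel_apply.1 h1
      refine ⟨t⁻¹, ?_, fun h' => absurd h' h⟩
      rw [inv_smul_eq_iff]; exact ht.symm
  choose t ht ht1 using hex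
  have hrr : ∀ a, r (r a) = r a := fun a => by
    conv_rhs => rw [← ht a]
    exact (hr _ _).symm
  refine ⟨{a : A // a ≠ r a} ⊕ (Σ b : {b : A // b = r b},
      IsFreeGroup.Generators (MulAction.stabilizer G b.1)),
    Sum.elim (fun a => t a.1) (fun p => (IsFreeGroup.of p.2 : MulAction.stabilizer G p.1.1)),
    Sum.elim (fun a => r a.1) (fun p => p.1.1), ?_⟩
  intro X _ f
  let l : A → X := fun a => if h : a ≠ r a then f (Sum.inl ⟨a, h⟩) else 1
  let φ : ∀ b : {b : A // b = r b}, MulAction.stabilizer G b.1 →* X := fun b =>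
    IsFreeGroup.lift (fun e => f (Sum.inr ⟨b, e⟩))
  let Φ : A → G → X := fun a g => if h : g ∈ MulAction.stabilizer G (r a) then
    φ ⟨r a, (hrr a).symm⟩ ⟨g, h⟩ else 1
  have hΦmul : ∀ a g h, g • r a = r a → h • r a = r a → Φ a (g * h) = Φ a g * Φ a h := by
    intro a g h hg hh
    have hgh : g * h ∈ MulAction.stabilizer G (r a) := by
      rw [MulAction.mem_stabilizer_iff, mul_smul, hh, hg]
    simp only [Φ]
    rw [dif_pos hgh, dif_pos (MulAction.mem_stabilizer_iff.2 hg),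
      dif_pos (MulAction.mem_stabilizer_iff.2 hh), ← map_mul]
    rfl
  have hΦr : ∀ a b, r a = r b → Φ a = Φ b := by
    intro a b hab
    simp only [Φ]
    funext g
    generalize_proofs p1 p2
    revert p1 p2
    rw [hab]
    intros; rfl
  have hst : ∀ (g : G) (a : A), ((t (g • a))⁻¹ * g * t a) • r a = r a := by
    intro g a
    rw [mul_smul, mul_smul, ht, inv_smul_eq_iff, ← hr g a, ht]
  refine ⟨fun g a => l (g • a) * Φ a ((t (g • a))⁻¹ * g * t a) * (l a)⁻¹, ⟨?_, ?_⟩, ?_⟩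
  · intro g h a
    simp only [MulAction.toPermHom_apply, MulAction.toPerm_apply]
    have h1 : (t ((g * h) • a))⁻¹ * (g * h) * t a =
      ((t (g • h • a))⁻¹ * g * t (h • a)) * ((t (h • a))⁻¹ * h * t a) := by
      rw [mul_smul]; group
    have h2 := hst g (h • a)
    rw [hr] at h2
    rw [h1, hΦmul a _ _ h2 (hst h a), hΦr (h • a) a (hr _ _), mul_smul]
    group
  · have hΦ1 : ∀ a, Φ a 1 = 1 := by
      intro a
      have := hΦmul a 1 1 (one_smul _ _) (one_smul _ _)
      simpa using this
    have hl : ∀ a, a = r a → l a = 1 := fun a ha => dif_neg (by simpa using ha)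
    rintro (⟨a, ha⟩ | ⟨⟨b, hb⟩, e⟩)
    · simp only [Sum.elim_inl]
      rw [ht, ht1 (r a) (hrr a).symm, hl (r a) (hrr a).symm]
      simp [hΦ1, l, ha]
    · simp only [Sum.elim_inr]
      have hm := (IsFreeGroup.of e : MulAction.stabilizer G b).2
      rw [MulAction.mem_stabilizer_iff] at hm
      rw [hm, hl b hb, ht1 b hb]
      simp only [inv_one, one_mul, mul_one]
      have hm' : ((IsFreeGroup.of e : MulAction.stabilizer G b) : G) ∈
        MulAction.stabilizer G (r b) := by
        rw [← hb]; exact (IsFreeGroup.of e : MulAction.stabilizer G b).2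
      simp only [Φ]
      rw [dif_pos hm']
      have : φ ⟨b, hb⟩ (IsFreeGroup.of e) = f (Sum.inr ⟨⟨b, hb⟩, e⟩) := by
        simp only [φ]
        rw [IsFreeGroup.lift_of]
      rw [← this]
      generalize IsFreeGroup.of e = x at *
      obtain ⟨x, hx⟩ := x
      simp only at *
      have key : ∀ (b' : A) (h1 : b' = r b') (h2 : x ∈ MulAction.stabilizer G b'), b = b' →
        φ ⟨b', h1⟩ ⟨x, h2⟩ = φ ⟨b, hb⟩ ⟨x, hx⟩ := by
        rintro b' h1 h2 rfl
        rfl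
      exact key _ _ _ hb
  · rintro c ⟨hc, hf⟩
    simp only [MulAction.toPermHom_apply, MulAction.toPerm_apply] at hc
    have hc1 : ∀ a, c 1 a = 1 := fun a => by
      have := hc 1 1 a
      simpa using this
    have hct : ∀ a, c (t a) (r a) = l a := by
      intro a
      by_cases ha : a = r a
      · rw [ht1 a ha, hc1]
        simp only [l]
        rw [dif_neg (by simpa using ha)]
      · simp only [l]
        rw [dif_pos ha]
        exact hf (Sum.inl ⟨a, ha⟩)
    have hcφ : ∀ (b : {b : A // b = r b}) (x : MulAction.stabilizer G b.1),
        c x b.1 = φ b x := by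
      intro b
      let ψ : MulAction.stabilizer G b.1 →* X := MonoidHom.mk' (fun x => c x b.1) (by
        intro x y
        have := MulAction.mem_stabilizer_iff.1 y.2
        simp only [Subgroup.coe_mul]
        rw [hc, this])
      have : ψ = φ b := by
        apply IsFreeGroup.ext_hom
        intro e
        simp only [φ]
        rw [IsFreeGroup.lift_of]
        exact hf (Sum.inr ⟨b, e⟩)
      intro x
      rw [← this]; rfl
    funext g a
    have h1 := hcφ ⟨r a, (hrr a).symm⟩ ⟨_, hst g a⟩
    have h2 : Φ a ((t (g • a))⁻¹ * g * t a) = φ ⟨r a, (hrr a).symm⟩ ⟨_, hst g a⟩ :=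
      dif_pos _
    rw [h2, ← h1, ← hct a, ← hct (g • a), hr]
    simp only
    have h3 := hc (t (g • a)) ((t (g • a))⁻¹ * g * t a) (r a)
    rw [hst] at h3
    rw [← h3]
    have h4 := hc g (t a) (r a)
    rw [ht] at h4
    rw [eq_mul_inv_iff_mul_eq, ← h4]
    congr 1
    group

theorem isFreeAct_coprodI {ι : Type} {G : ι → Type} [∀ i, Group (G i)] {A : Type}
    (ρ : Monoid.CoprodI G →* Equiv.Perm A)
    (h : ∀ i, IsFreeAct (ρ.comp (Monoid.CoprodI.of (i := i)))) : IsFreeAct ρ := by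
  choose E γ s hE using h
  refine ⟨Σ i, E i, fun e => Monoid.CoprodI.of (γ e.1 e.2), fun e => s e.1 e.2, ?_⟩
  intro X _ f
  have h' := fun i => hE i X (fun e => f ⟨i, e⟩)
  choose c hc hu using h'
  simp only at hc hu
  have hc1 : ∀ i a, c i 1 a = 1 := fun i a => by
    have := (hc i).1 1 1 a
    simpa using this
  let F : Monoid.CoprodI G →* Function.End (A × X) := Monoid.CoprodI.lift fun i =>
    { toFun := fun g p => (ρ (Monoid.CoprodI.of g) p.1, c i g p.1 * p.2)
      map_one' := by
        funext p
        simp [hc1, Function.End.one_def]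
      map_mul' := by
        intro g k
        funext p
        have := (hc i).1 g k p.1
        simp only [MonoidHom.comp_apply] at this
        change _ = (ρ (Monoid.CoprodI.of g) (ρ (Monoid.CoprodI.of k) p.1),
          c i g (ρ (Monoid.CoprodI.of k) p.1) * (c i k p.1 * p.2))
        simp [this, mul_assoc] }
  have hFof : ∀ i (g : G i) p, F (Monoid.CoprodI.of g) p =
      (ρ (Monoid.CoprodI.of g) p.1, c i g p.1 * p.2) := by
    intro i g p
    simp only [F, Monoid.CoprodI.lift_of]
    rfl
  have hFmul : ∀ w v p, F (w * v) p = F w (F v p) := by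
    intro w v p
    rw [map_mul]; rfl
  have hF : ∀ w a x, F w (a, x) = (ρ w a, (F w (a, 1)).2 * x) := by
    intro w
    induction w using Monoid.CoprodI.induction_on with
    | one => intro a x; simp [Function.End.one_def]
    | of i g => intro a x; simp [hFof]
    | mul w v hw hv =>
      intro a x
      rw [hFmul, hFmul, hv a x, hv a 1, hw _ (_ * x), hw _ (_ * 1)]
      simp [mul_assoc]
  refine ⟨fun w a => (F w (a, 1)).2, ⟨?_, ?_⟩, ?_⟩
  · intro w v a
    simp only
    rw [hFmul, hF v a 1, hF w, mul_one]
  · rintro ⟨i, e⟩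
    simp only [hFof, mul_one]
    exact (hc i).2 e
  · rintro d ⟨hd, hdf⟩
    have hd1 : ∀ a, d 1 a = 1 := fun a => by
      have := hd 1 1 a
      simpa using this
    funext w
    induction w using Monoid.CoprodI.induction_on with
    | one => funext a; simp [hd1, Function.End.one_def]
    | of i g =>
      have := hu i (fun g a => d (Monoid.CoprodI.of g) a) ⟨by
        intro g k a
        simp [hd], fun e => hdf ⟨i, e⟩⟩
      funext a
      simp only [hFof, mul_one]
      exact congrFun (congrFun this g) a
    | mul w v hw hv =>
      funext a
      rw [hd, hw, hv, hFmul, hF v a 1, hF w]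
      simp

open CategoryTheory in
theorem isFreeGroup_of_isFreeAct {G : Type} [Group G] (H : Subgroup G)
    (h : IsFreeAct (MulAction.toPermHom G (G ⧸ H))) : IsFreeGroup H := by
  obtain ⟨E, γ, s, hE⟩ := h
  let inst : IsFreeGroupoid (ActionCategory G (G ⧸ H)) :=
    { quiverGenerators := ⟨fun a b => {e : E // s e = ActionCategory.back (M := G) a ∧
        γ e • s e = ActionCategory.back (M := G) b}⟩
      of := fun {a b} e => ⟨γ e.1, (congrArg _ e.2.1.symm).trans e.2.2⟩
      unique_lift := by
        intro X _ f
        obtain ⟨c, ⟨hc, hcf⟩, hu⟩ := hE X (fun e =>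
          f (a := (⟨(), s e⟩ : ActionCategory G (G ⧸ H)))
            (b := (⟨(), γ e • s e⟩ : ActionCategory G (G ⧸ H))) ⟨e, rfl, rfl⟩)
        have hc1 : ∀ a, c 1 a = 1 := fun a => by
          have := hc 1 1 a
          simpa using this
        let F : ActionCategory G (G ⧸ H) ⥤ SingleObj X :=
          { obj := fun _ => ()
            map := fun {a b} p => c p.1 a.back
            map_id := fun a => hc1 _
            map_comp := by
              intro a b d p q
              have h1 := hc q.1 p.1 a.back
              have h2 : p.1 • a.back = b.back := p.2
              simp only [MulAction.toPermHom_apply, MulAction.toPerm_apply] at h1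
              rw [h2] at h1
              exact h1 }
        refine ⟨F, ?_, ?_⟩
        · rintro ⟨⟨⟩, a⟩ ⟨⟨⟩, b⟩ ⟨e, h1, h2⟩
          change s e = a at h1
          change γ e • s e = b at h2
          subst h1
          subst h2
          exact hcf e
        · intro D hD
          let d : G → (G ⧸ H) → X := fun g a =>
            D.map (X := (⟨(), a⟩ : ActionCategory G (G ⧸ H)))
              (Y := (⟨(), g • a⟩ : ActionCategory G (G ⧸ H))) ⟨g, rfl⟩
          have hdD : ∀ (a b : ActionCategory G (G ⧸ H)) (p : a ⟶ b), D.map p = d p.1 a.back := by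
            have key : ∀ (g : G) (a b : G ⧸ H) (h2 : g • a = b),
                D.map (X := (⟨(), a⟩ : ActionCategory G (G ⧸ H)))
                  (Y := (⟨(), b⟩ : ActionCategory G (G ⧸ H))) ⟨g, h2⟩ = d g a := by
              rintro g a b rfl
              rfl
            rintro ⟨⟨⟩, a⟩ ⟨⟨⟩, b⟩ ⟨g, h2⟩
            exact key g a b h2
          have hd : d = c := by
            apply hu
            refine ⟨?_, ?_⟩
            · intro g k a
              let o : G ⧸ H → ActionCategory G (G ⧸ H) := fun a => ⟨(), a⟩
              let p : o a ⟶ o (k • a) := ⟨k, rfl⟩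
              let q : o (k • a) ⟶ o (g • k • a) := ⟨g, rfl⟩
              have h1 := D.map_comp p q
              exact (hdD _ _ (p ≫ q)).symm.trans h1
            · intro e
              exact hD (⟨(), s e⟩ : ActionCategory G (G ⧸ H))
                (⟨(), γ e • s e⟩ : ActionCategory G (G ⧸ H)) ⟨e, rfl, rfl⟩
          refine Functor.hext (fun _ => rfl) ?_
          intro a b p
          apply heq_of_eq
          have := hdD a b p
          rw [hd] at this
          exact this }
  let x : ActionCategory G (G ⧸ H) := ActionCategory.objEquiv G (G ⧸ H) ↑(1 : G)
  have hconn : @IsConnected (ActionCategory G (G ⧸ H)) (Groupoid.toCategory) :=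
    (inferInstance : @IsConnected (ActionCategory G (G ⧸ H)) _)
  have h1 := @IsFreeGroupoid.endIsFreeOfConnectedFree _ _ hconn inst x
  exact @IsFreeGroup.ofMulEquiv (End x) (@End.group _ inferInstance x) h1 H _
    (ActionCategory.endMulEquivSubgroup H)

/-- A free product of finitely many groups, each of which is finite or contains a normal
finite-index subgroup isomorphic to `ℤ`, is virtually free. -/
theorem coprodI_virtually_free (ι : Type) [Finite ι] (G : ι → Type) [∀ i, Group (G i)]
    (h : ∀ i, Finite (G i) ∨ ∃ N : Subgroup (G i), N.Normal ∧ N.FiniteIndex ∧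
      Nonempty (N ≃* Multiplicative ℤ)) :
    ∃ H : Subgroup (Monoid.CoprodI G), H.FiniteIndex ∧
      ∃ S : Type, Nonempty (H ≃* FreeGroup S) := by
  classical
  have h' : ∀ i, ∃ N : Subgroup (G i), N.Normal ∧ N.FiniteIndex ∧ IsFreeGroup N := by
    intro i
    rcases h i with hi | ⟨N, h1, h2, ⟨e⟩⟩
    · refine ⟨⊥, inferInstance, inferInstance, ?_⟩
      exact IsFreeGroup.ofMulEquiv
        (MulEquiv.ofUnique : FreeGroup Empty ≃* (⊥ : Subgroup (G i)))
    · exact ⟨N, h1, h2, IsFreeGroup.ofMulEquiv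
        ((FreeGroup.mulEquivIntOfUnique (α := Unit)).trans e.symm)⟩
  choose N hN hfi hfree using h'
  let q : Monoid.CoprodI G →* (∀ i, G i ⧸ N i) := Monoid.CoprodI.lift fun i =>
    (MonoidHom.mulSingle (fun i => G i ⧸ N i) i).comp (QuotientGroup.mk' (N i))
  have hfin : Finite (∀ i, G i ⧸ N i) := inferInstance
  have hker : q.ker.FiniteIndex := inferInstance
  refine ⟨q.ker, hker, ?_⟩
  have hF : IsFreeGroup q.ker := by
    apply isFreeGroup_of_isFreeAct
    apply isFreeAct_coprodI
    intro i
    letI : MulAction (G i) (Monoid.CoprodI G ⧸ q.ker) :=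
      MulAction.compHom _ (Monoid.CoprodI.of (i := i) (M := G))
    apply isFreeAct_of_stabilizer
    intro a
    have hle : MulAction.stabilizer (G i) a ≤ N i := by
      intro g hg
      rw [MulAction.mem_stabilizer_iff] at hg
      induction a using QuotientGroup.induction_on with
      | H w =>
        have h1 : ((Monoid.CoprodI.of g * w : Monoid.CoprodI G) : Monoid.CoprodI G ⧸ q.ker) = w :=
          hg
        rw [eq_comm, QuotientGroup.eq, MonoidHom.mem_ker] at h1
        have h2 : q (Monoid.CoprodI.of g) = 1 := by
          rw [map_mul, map_mul, map_inv, inv_mul_eq_one] at h1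
          exact right_eq_mul.1 h1
        have h3 := congrFun h2 i
        simp only [q, Monoid.CoprodI.lift_of, MonoidHom.comp_apply, MonoidHom.mulSingle_apply,
          Pi.mulSingle_eq_same, Pi.one_apply] at h3
        exact (QuotientGroup.eq_one_iff g).1 h3
    exact IsFreeGroup.ofMulEquiv (Subgroup.subgroupOfEquivOfLe hle)
  exact ⟨_, ⟨IsFreeGroup.toFreeGroup q.ker⟩⟩
end
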